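/- arXiv:0711.2987 — 8 statements merged into one kernel-verified Lean document; each statement's English description precedes it below -/
import Mathlib

section
/- Let L be a Lie algebra over ℝ and let p, q, h be ℝ-submodules of L with q ∩ h = {0} and p ∩ (q + h) = {0}, satisfying [h,h] ⊆ h, [h,q] ⊆ q, [q,q] ⊆ h, [q+h, p] ⊆ p and [p,p] ⊆ q + h. Let d be a nonzero real number. For X_p, Y_p ∈ p, X_q, Y_q ∈ q, X_h, Y_h ∈ h set X̃ = X_p + X_q + d•X_h, X̃_k = X_q + d•X_h, and similarly Ỹ, Ỹ_k. Then the following are equivalent: (i) [X̃,Ỹ] = 0, [X̃_k,Ỹ_k] = 0 and [X_h,Y_h] = 0; (ii) [X̃,Ỹ] = 0, [X̃_k,Ỹ_k] = 0, [X_p,Y_p] = 0, [X_q,Y_q] = 0 and [X_h,Y_h] = 0. -/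
/-- Example 2 of the paper: for a chain of symmetric pairs giving
g = p ⊕ q ⊕ h, the zero-curvature condition (8) for the twice
Cheeger-contracted metric, `[X̃,Ỹ] = 0`, `[X̃_k,Ỹ_k] = 0`, `[X_h,Y_h] = 0`
(where X̃ = X_p + X_q + d•X_h, X̃_k = X_q + d•X_h), is equivalent to the
vanishing of all component brackets. -/
theorem stmt1 (L : Type*) [LieRing L] [LieAlgebra ℝ L]
    (p q h : Submodule ℝ L)
    (h_qh : q ⊓ h = ⊥) (h_p_qh : p ⊓ (q ⊔ h) = ⊥)
    (hhh : ∀ x ∈ h, ∀ y ∈ h, ⁅x, y⁆ ∈ h)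
    (hhq : ∀ x ∈ h, ∀ y ∈ q, ⁅x, y⁆ ∈ q)
    (hqq : ∀ x ∈ q, ∀ y ∈ q, ⁅x, y⁆ ∈ h)
    (hkp : ∀ x ∈ q ⊔ h, ∀ y ∈ p, ⁅x, y⁆ ∈ p)
    (hpp : ∀ x ∈ p, ∀ y ∈ p, ⁅x, y⁆ ∈ q ⊔ h)
    (d : ℝ) (hd : d ≠ 0)
    (Xp Yp : L) (hXp : Xp ∈ p) (hYp : Yp ∈ p)
    (Xq Yq : L) (hXq : Xq ∈ q) (hYq : Yq ∈ q)
    (Xh Yh : L) (hXh : Xh ∈ h) (hYh : Yh ∈ h) :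
    (⁅Xp + Xq + d • Xh, Yp + Yq + d • Yh⁆ = 0 ∧
        ⁅Xq + d • Xh, Yq + d • Yh⁆ = 0 ∧ ⁅Xh, Yh⁆ = 0) ↔
      (⁅Xp + Xq + d • Xh, Yp + Yq + d • Yh⁆ = 0 ∧
        ⁅Xq + d • Xh, Yq + d • Yh⁆ = 0 ∧
        ⁅Xp, Yp⁆ = 0 ∧ ⁅Xq, Yq⁆ = 0 ∧ ⁅Xh, Yh⁆ = 0) := by
  refine ⟨fun ⟨hX, hk, hh⟩ => ⟨hX, hk, ?_, ?_, hh⟩, fun ⟨hX, hk, _, _, hh⟩ => ⟨hX, hk, hh⟩⟩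
  · have hXk : Xq + d • Xh ∈ q ⊔ h := Submodule.add_mem_sup hXq (h.smul_mem d hXh)
    have hYk : Yq + d • Yh ∈ q ⊔ h := Submodule.add_mem_sup hYq (h.smul_mem d hYh)
    have key : ⁅Xp, Yp⁆ = ⁅Yq + d • Yh, Xp⁆ - ⁅Xq + d • Xh, Yp⁆ := by
      rw [add_assoc, add_assoc, add_lie Xp, lie_add Xp Yp, lie_add (Xq + d • Xh) Yp, hk, add_zero,
        ← lie_skew Xp (Yq + d • Yh)] at hX
      rw [← sub_eq_zero, ← hX]
      abel
    have mem : ⁅Xp, Yp⁆ ∈ p ⊓ (q ⊔ h) := by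
      refine ⟨?_, hpp _ hXp _ hYp⟩
      rw [key]
      exact p.sub_mem (hkp _ hYk _ hXp) (hkp _ hXk _ hYp)
    rwa [h_p_qh, Submodule.mem_bot] at mem
  · have key : ⁅Xq, Yq⁆ = d • ⁅Yh, Xq⁆ - d • ⁅Xh, Yq⁆ := by
      rw [add_lie, lie_add, lie_add, smul_lie, lie_smul, smul_lie, lie_smul, hh, smul_zero,
        smul_zero, add_zero, ← lie_skew Xq Yh, smul_neg] at hk
      rw [← sub_eq_zero, ← hk]
      abel
    have mem : ⁅Xq, Yq⁆ ∈ q ⊓ h := by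
      refine ⟨?_, hqq _ hXq _ hYq⟩
      rw [key]
      exact q.sub_mem (q.smul_mem d (hhq _ hYh _ hXq)) (q.smul_mem d (hhq _ hXh _ hYq))
    rwa [h_qh, Submodule.mem_bot] at mem
end

section
/- For x, y ∈ ℍ, let P(x) denote the 2×2 quaternionic matrix with rows (0, −x̄) and (x, 0), and similarly P(y). Then P(x)·P(y) = P(y)·P(x) if and only if x and y are linearly dependent over ℝ (i.e. there exist reals r, s, not both zero, with r•x = s•y). -/
open scoped Quaternion
open Matrix

/-- The off-diagonal matrix P(x) with rows (0, −x̄) and (x, 0). -/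
noncomputable def Pmat (x : ℍ[ℝ]) : Matrix (Fin 2) (Fin 2) ℍ[ℝ] := !![0, -star x; x, 0]

theorem Pmat_mul_comm_iff (x y : ℍ[ℝ]) :
    Pmat x * Pmat y = Pmat y * Pmat x ↔
      star x * y = star y * x ∧ x * star y = y * star x := by
  simp [Pmat]

theorem Pmat_smul_commute (c : ℝ) (y : ℍ[ℝ]) : Pmat (c • y) * Pmat y = Pmat y * Pmat (c • y) := by
  simp [Pmat_mul_comm_iff, Quaternion.star_smul]

/-- Section 3 of the paper: two off-diagonal matrices P(x), P(y) commute
iff x and y are linearly dependent over ℝ. -/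
theorem stmt2 (x y : ℍ[ℝ]) :
    Pmat x * Pmat y = Pmat y * Pmat x ↔
      ∃ r s : ℝ, ¬(r = 0 ∧ s = 0) ∧ r • x = s • y := by
  constructor
  · intro h
    obtain ⟨h, -⟩ := (Pmat_mul_comm_iff x y).1 h
    by_cases hx : x = 0
    · exact ⟨1, 0, by simp, by simp [hx]⟩
    have h_real : star x * y = ((star x * y).re : ℍ[ℝ]) :=
      Quaternion.star_eq_self.1 (by rw [star_mul, star_star, h])
    refine ⟨(star x * y).re, Quaternion.normSq x,
      fun h0 => hx (Quaternion.normSq_eq_zero.1 h0.2), ?_⟩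
    rw [← Quaternion.mul_coe_eq_smul, ← h_real, ← mul_assoc, Quaternion.self_mul_star,
      Quaternion.coe_mul_eq_smul]
  · rintro ⟨r, s, hrs, h⟩
    by_cases hr : r = 0
    · have hs : s ≠ 0 := fun hs => hrs ⟨hr, hs⟩
      rw [eq_inv_smul_iff₀ hs |>.2 h.symm, smul_smul]
      exact (Pmat_smul_commute _ x).symm
    · rw [eq_inv_smul_iff₀ hr |>.2 h, smul_smul]
      exact Pmat_smul_commute _ y
end

section
/- Let 0 < t̃ < 1 and let X, Y ∈ sp(2) satisfy [X̃,Ỹ] = 0, [X̃_k,Ỹ_k] = 0, [X_p,Y_p] = 0, [X_q,Y_q] = 0 and [X_h,Y_h] = 0, and suppose X̃ and Ỹ are linearly independent over ℝ. Then there exist x ∈ ℍ and y ∈ Im ℍ such that the plane span_ℝ{X̃, Ỹ} is spanned by one of the following pairs of 2×2 quaternionic matrices: (1) diag(y,0) and diag(0,y), with y ≠ 0; (2) the matrix with rows (0, −x̄), (x, 0) and the matrix diag(y, x·y·x⁻¹), with x ≠ 0 and y ≠ 0; (3) the matrix with rows (y, −x̄), (x, −ε•y) and the matrix diag(y, ε•y),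 where ε ∈ {1, −1}, x ≠ 0, y ≠ 0 and x·y·x⁻¹ = ε•y. -/
open scoped Quaternion
open Matrix

noncomputable section

/-- 2×2 quaternionic matrices. -/
abbrev M2 : Type := Matrix (Fin 2) (Fin 2) ℍ[ℝ]

/-- Diagonal 2×2 matrix diag(x,y). -/
def dg (x y : ℍ[ℝ]) : M2 := !![x, 0; 0, y]

/-- Diagonal (k-)part of a 2×2 matrix. -/
def Kpart (A : M2) : M2 := dg (A 0 0) (A 1 1)

/-- Off-diagonal (p-)part of a 2×2 matrix. -/
def Ppart (A : M2) : M2 := A - Kpart A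

/-- h-part of a 2×2 matrix. -/
def Hpart (A : M2) : M2 := dg ((A 0 0 + A 1 1) / 2) ((A 0 0 + A 1 1) / 2)

/-- q-part of a 2×2 matrix. -/
def Qpart (A : M2) : M2 := dg ((A 0 0 - A 1 1) / 2) ((A 1 1 - A 0 0) / 2)

/-- X̃ = X_p + X_q + t̃•X_h. -/
def tdX (t : ℝ) (A : M2) : M2 := Ppart A + Qpart A + t • Hpart A

/-- X̃_k = X_q + t̃•X_h. -/
def tdK (t : ℝ) (A : M2) : M2 := Qpart A + t • Hpart A

/-- Commutator of 2×2 quaternionic matrices. -/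
def br (A B : M2) : M2 := A * B - B * A

theorem span_pair_eq_of_det_ne_zero {M : Type*} [AddCommGroup M] [Module ℝ M] {U V P Q : M}
    {a b c d : ℝ} (hU : U = a • P + b • Q) (hV : V = c • P + d • Q) (hdet : a * d - b * c ≠ 0) :
    Submodule.span ℝ {U, V} = Submodule.span ℝ {P, Q} := by
  apply le_antisymm
  · rw [Submodule.span_le]
    rintro z (rfl | rfl)
    · exact Submodule.mem_span_pair.2 ⟨a, b, hU.symm⟩
    · exact Submodule.mem_span_pair.2 ⟨c, d, hV.symm⟩
  · obtain ⟨e, he⟩ : ∃ e, (a * d - b * c) * e = 1 := ⟨_, mul_inv_cancel₀ hdet⟩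
    rw [Submodule.span_le]
    rintro z (rfl | rfl)
    · refine Submodule.mem_span_pair.2 ⟨d * e, -b * e, ?_⟩
      rw [hU, hV]
      match_scalars
      · linear_combination he
      · ring
    · refine Submodule.mem_span_pair.2 ⟨-c * e, a * e, ?_⟩
      rw [hU, hV]
      match_scalars
      · ring
      · linear_combination he

theorem Quaternion.exists_smul_eq_of_star_mul_comm {u v : ℍ[ℝ]} (hu : u ≠ 0)
    (h : star u * v = star v * u) : ∃ r : ℝ, v = r • u := by
  have hs : star (star u * v) = star u * v := by rw [star_mul, star_star, h]
  obtain ⟨c, hc⟩ : ∃ c : ℝ, star u * v = c :=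
    ⟨_, Quaternion.star_eq_self.1 hs⟩
  have hn : Quaternion.normSq u ≠ 0 := Quaternion.normSq_ne_zero.2 hu
  refine ⟨(Quaternion.normSq u)⁻¹ * c, ?_⟩
  have key : (Quaternion.normSq u : ℝ) • v = c • u := by
    rw [← Quaternion.coe_mul_eq_smul, ← Quaternion.self_mul_star, mul_assoc, hc,
      Quaternion.mul_coe_eq_smul]
  rw [mul_smul, ← key, inv_smul_smul₀ hn]

theorem Quaternion.exists_smul_eq_of_mul_comm {u v : ℍ[ℝ]} (hu : u ≠ 0)
    (hur : u.re = 0) (hvr : v.re = 0) (h : u * v = v * u) : ∃ r : ℝ, v = r • u := by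
  apply Quaternion.exists_smul_eq_of_star_mul_comm hu
  rw [Quaternion.star_eq_neg.2 hur, Quaternion.star_eq_neg.2 hvr, neg_mul, neg_mul, h]

/-- The skew-Hermitian matrix with `q`-part `q`, `h`-part `h` and off-diagonal entry `x`. -/
def skewMk (q h x : ℍ[ℝ]) : M2 := !![q + h, -star x; x, h - q]

/-- The planes of the three types in the classification. -/
def IsFlatPlane (S : Submodule ℝ M2) : Prop :=
  ∃ x y : ℍ[ℝ], y.re = 0 ∧
    ((y ≠ 0 ∧ S = Submodule.span ℝ {dg y 0, dg 0 y}) ∨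
     (x ≠ 0 ∧ y ≠ 0 ∧
        S = Submodule.span ℝ {(!![0, -star x; x, 0] : M2), dg y (x * y * x⁻¹)}) ∨
     (∃ ε : ℝ, (ε = 1 ∨ ε = -1) ∧ x ≠ 0 ∧ y ≠ 0 ∧ x * y * x⁻¹ = ε • y ∧
        S = Submodule.span ℝ {(!![y, -star x; x, -(ε • y)] : M2), dg y (ε • y)}))

theorem isFlatPlane_of_diagonal_of_ne_zero {q h q' h' : ℍ[ℝ]} (hq : q.re = 0) (hh : h.re = 0)
    (hq' : q'.re = 0) (hh' : h'.re = 0) (cq : q * q' = q' * q) (ch : h * h' = h' * h)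
    (cc : q * h' + h * q' = h' * q + q' * h)
    (hind : LinearIndependent ℝ ![skewMk q h 0, skewMk q' h' 0]) (q0 : q ≠ 0) :
    IsFlatPlane (Submodule.span ℝ {skewMk q h 0, skewMk q' h' 0}) := by
  obtain ⟨r, rfl⟩ := Quaternion.exists_smul_eq_of_mul_comm q0 hq hq' cq
  obtain ⟨y, rfl⟩ : ∃ y, h' = y + r • h := ⟨h' - r • h, by simp⟩
  have hy : y.re = 0 := by simpa [hh] using hh'
  have y0 : y ≠ 0 := by
    rintro rfl
    have := LinearIndependent.pair_iff.1 hind r (-1) (by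
      ext1 i j
      fin_cases i <;> fin_cases j <;> simp [skewMk]
      module)
    norm_num at this
  have cy : y * q = q * y := by
    simp only [mul_add, add_mul, mul_smul_comm, smul_mul_assoc] at cc
    rw [← sub_eq_zero] at cc ⊢
    rw [← neg_eq_zero, ← cc]
    module
  have chy : y * h = h * y := by
    simp only [mul_add, add_mul, mul_smul_comm, smul_mul_assoc] at ch
    exact (add_right_cancel ch).symm
  obtain ⟨u, rfl⟩ := Quaternion.exists_smul_eq_of_mul_comm y0 hy hq cy
  obtain ⟨s, rfl⟩ := Quaternion.exists_smul_eq_of_mul_comm y0 hy hh chy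
  have u0 : u ≠ 0 := by rintro rfl; simp at q0
  refine ⟨0, y, hy, Or.inl ⟨y0, ?_⟩⟩
  apply span_pair_eq_of_det_ne_zero (a := u + s) (b := s - u) (c := r * (u + s) + 1)
    (d := r * (s - u) + 1)
  · ext1 i j
    fin_cases i <;> fin_cases j <;> simp [skewMk, dg] <;> module
  · ext1 i j
    fin_cases i <;> fin_cases j <;> simp [skewMk, dg] <;> module
  · ring_nf
    simpa using u0

theorem isFlatPlane_of_diagonal {q h q' h' : ℍ[ℝ]} (hq : q.re = 0) (hh : h.re = 0)
    (hq' : q'.re = 0) (hh' : h'.re = 0) (cq : q * q' = q' * q) (ch : h * h' = h' * h)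
    (cc : q * h' + h * q' = h' * q + q' * h)
    (hind : LinearIndependent ℝ ![skewMk q h 0, skewMk q' h' 0]) :
    IsFlatPlane (Submodule.span ℝ {skewMk q h 0, skewMk q' h' 0}) := by
  by_cases q0 : q = 0
  · by_cases q0' : q' = 0
    · subst q0 q0'
      exfalso
      rw [LinearIndependent.pair_iff] at hind
      have h0 : h ≠ 0 := by
        rintro rfl
        simpa using hind 1 0 (by ext1 i j; fin_cases i <;> fin_cases j <;> simp [skewMk])
      obtain ⟨r, rfl⟩ := Quaternion.exists_smul_eq_of_mul_comm h0 hh hh' ch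
      simpa using hind r (-1) (by ext1 i j; fin_cases i <;> fin_cases j <;> simp [skewMk])
    · rw [Set.pair_comm]
      refine isFlatPlane_of_diagonal_of_ne_zero hq' hh' hq hh cq.symm ch.symm ?_
        (LinearIndependent.pair_symm_iff.1 hind) q0'
      rw [add_comm, ← cc, add_comm]
  · exact isFlatPlane_of_diagonal_of_ne_zero hq hh hq' hh' cq ch cc hind q0

theorem isFlatPlane_of_ne_zero {q h q' h' x : ℍ[ℝ]} (hq : q.re = 0) (hh : h.re = 0)
    (hq' : q'.re = 0) (hh' : h'.re = 0) (cq : q * q' = q' * q) (ch : h * h' = h' * h)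
    (cc : q * h' + h * q' = h' * q + q' * h) (x0 : x ≠ 0)
    (cx : x * (q' + h') = (h' - q') * x)
    (hind : LinearIndependent ℝ ![skewMk q h x, skewMk q' h' 0]) :
    IsFlatPlane (Submodule.span ℝ {skewMk q h x, skewMk q' h' 0}) := by
  obtain ⟨b₁, hb₁⟩ : ∃ b, b = q' + h' := ⟨_, rfl⟩
  obtain ⟨b₂, hb₂⟩ : ∃ b, b = h' - q' := ⟨_, rfl⟩
  rw [← hb₁, ← hb₂] at cx
  have b₁re : b₁.re = 0 := by simp [hb₁, hq', hh']
  have b₂re : b₂.re = 0 := by simp [hb₂, hq', hh']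
  have b₂eq : b₂ = x * b₁ * x⁻¹ := by rw [cx, mul_assoc, mul_inv_cancel₀ x0, mul_one]
  have b₁0 : b₁ ≠ 0 := by
    intro h0
    rw [h0] at b₂eq hb₁
    simp only [mul_zero, zero_mul] at b₂eq
    rw [b₂eq] at hb₂
    simpa using LinearIndependent.pair_iff.1 hind 0 1 (by
      ext1 i j
      fin_cases i <;> fin_cases j <;> simp [skewMk, ← hb₁, ← hb₂])
  have b₂0 : b₂ ≠ 0 := by rw [b₂eq]; simp [x0, b₁0]
  have c₁ : b₁ * (q + h) = (q + h) * b₁ := by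
    rw [hb₁, ← sub_eq_zero]
    rw [← sub_eq_zero] at cq ch cc
    simp only [mul_add, add_mul]
    have : -(q * q' - q' * q) - (h * h' - h' * h) -
      (q * h' + h * q' - (h' * q + q' * h)) = 0 := by rw [cq, ch, cc]; simp
    rw [← this]; abel
  have c₂ : b₂ * (h - q) = (h - q) * b₂ := by
    rw [hb₂, ← sub_eq_zero]
    rw [← sub_eq_zero] at cq ch cc
    simp only [mul_sub, sub_mul]
    have : -(q * q' - q' * q) - (h * h' - h' * h) +
      (q * h' + h * q' - (h' * q + q' * h)) = 0 := by rw [cq, ch, cc]; simp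
    rw [← this]; abel
  obtain ⟨r, hr⟩ := Quaternion.exists_smul_eq_of_mul_comm b₁0 b₁re (by simp [hq, hh]) c₁
  obtain ⟨s, hs⟩ := Quaternion.exists_smul_eq_of_mul_comm b₂0 b₂re (by simp [hq, hh]) c₂
  have hU : skewMk q h x = !![r • b₁, -star x; x, s • b₂] := by rw [skewMk, hr, hs]
  have hV : skewMk q' h' 0 = dg b₁ b₂ := by simp [skewMk, dg, hb₁, hb₂]
  rw [hU, hV]
  by_cases hrs : s = r
  · subst hrs
    refine ⟨x, b₁, b₁re, Or.inr (Or.inl ⟨x0, b₁0, ?_⟩)⟩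
    rw [← b₂eq]
    apply span_pair_eq_of_det_ne_zero (a := 1) (b := s) (c := 0) (d := 1)
    · ext1 i j
      fin_cases i <;> fin_cases j <;> simp [dg]
    · simp
    · simp
  · have hc : s - r ≠ 0 := sub_ne_zero.2 hrs
    have hqq : q = r • q' - ((s - r) / 2) • b₂ := by
      have e : (2 : ℝ) • q = r • b₁ - s • b₂ := by rw [← hr, ← hs]; module
      have : q = (1 / 2 : ℝ) • (2 : ℝ) • q := by module
      rw [this, e, hb₁, hb₂]; module
    have cb : b₂ * q' = q' * b₂ := by
      rw [hqq] at cq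
      simp only [sub_mul, mul_sub, smul_mul_assoc, mul_smul_comm] at cq
      exact smul_right_injective _ (div_ne_zero hc two_ne_zero) (sub_right_injective cq)
    obtain ⟨ρ, hρ⟩ := Quaternion.exists_smul_eq_of_mul_comm b₂0 b₂re hq' cb
    have hb₁' : b₁ = (2 * ρ + 1) • b₂ := by
      have : b₁ = (2 : ℝ) • q' + b₂ := by rw [hb₁, hb₂]; module
      rw [this, hρ]; module
    obtain ⟨ε, hε⟩ : ∃ ε, ε = 2 * ρ + 1 := ⟨_, rfl⟩
    rw [← hε] at hb₁'
    have hn : ‖b₁‖ = ‖b₂‖ := by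
      have := congrArg norm cx
      rw [norm_mul, norm_mul, mul_comm] at this
      exact mul_right_cancel₀ (norm_ne_zero_iff.2 x0) this
    have hε1 : ε = 1 ∨ ε = -1 := by
      rw [hb₁', norm_smul, Real.norm_eq_abs] at hn
      exact eq_or_eq_neg_of_abs_eq (mul_right_cancel₀ (norm_ne_zero_iff.2 b₂0) (by simpa using hn))
    have hεε : ε * ε = 1 := by rcases hε1 with h | h <;> simp [h]
    have hb₂' : b₂ = ε • b₁ := by rw [hb₁', smul_smul, hεε, one_smul]
    refine ⟨x, (-((s - r) / 2)) • b₁, by simp [b₁re], Or.inr (Or.inr ⟨ε, hε1, x0, ?_, ?_, ?_⟩)⟩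
    · exact smul_ne_zero (neg_ne_zero.2 (div_ne_zero hc two_ne_zero)) b₁0
    · rw [mul_smul_comm, smul_mul_assoc, ← b₂eq, hb₂', smul_comm]
    · rw [hb₂']
      apply span_pair_eq_of_det_ne_zero (a := 1) (b := -(r + s) / (s - r)) (c := 0)
        (d := -2 / (s - r))
      · ext1 i j
        fin_cases i <;> fin_cases j <;> simp [dg] <;> match_scalars <;> field_simp <;> ring
      · ext1 i j
        fin_cases i <;> fin_cases j <;> simp [dg] <;> match_scalars <;> field_simp
      · simp [hc]

theorem isFlatPlane_of_ne_zero_of_star_mul_comm {q h q' h' x y : ℍ[ℝ]} (hq : q.re = 0)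
    (hh : h.re = 0) (hq' : q'.re = 0) (hh' : h'.re = 0) (cq : q * q' = q' * q)
    (ch : h * h' = h' * h) (cc : q * h' + h * q' = h' * q + q' * h) (x0 : x ≠ 0)
    (cxy : star x * y = star y * x)
    (cx : x * (q' + h') + (h - q) * y = y * (q + h) + (h' - q') * x)
    (hind : LinearIndependent ℝ ![skewMk q h x, skewMk q' h' y]) :
    IsFlatPlane (Submodule.span ℝ {skewMk q h x, skewMk q' h' y}) := by
  obtain ⟨r, rfl⟩ := Quaternion.exists_smul_eq_of_star_mul_comm x0 cxy
  obtain ⟨p, rfl⟩ : ∃ p, q' = p + r • q := ⟨q' - r • q, by simp⟩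
  obtain ⟨k, rfl⟩ : ∃ k, h' = k + r • h := ⟨h' - r • h, by simp⟩
  have e : skewMk (p + r • q) (k + r • h) (r • x) = r • skewMk q h x + (1 : ℝ) • skewMk p k 0 := by
    ext1 i j
    fin_cases i <;> fin_cases j <;> simp [skewMk] <;> module
  have hspan : Submodule.span ℝ {skewMk q h x, skewMk (p + r • q) (k + r • h) (r • x)} =
      Submodule.span ℝ {skewMk q h x, skewMk p k 0} :=
    span_pair_eq_of_det_ne_zero (a := 1) (b := 0) (by simp) e (by simp)
  rw [hspan]
  simp only [mul_add, add_mul, sub_mul, mul_smul_comm, smul_mul_assoc] at cq ch cc cx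
  refine isFlatPlane_of_ne_zero hq hh (by simpa [hq] using hq') (by simpa [hh] using hh')
    (add_right_cancel cq) (add_right_cancel ch) ?_ x0 ?_ ?_
  · rw [← sub_eq_zero] at cc ⊢
    rw [← cc]; abel
  · simp only [mul_add, sub_mul]
    rw [← sub_eq_zero] at cx ⊢
    rw [← cx]; module
  · rw [LinearIndependent.pair_iff] at hind ⊢
    intro a b hab
    have := hind (a - b * r) b (by rw [e, ← hab]; module)
    obtain ⟨h1, rfl⟩ := this
    simpa using h1

theorem isFlatPlane_of_commute {q h q' h' x y : ℍ[ℝ]} (hq : q.re = 0)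
    (hh : h.re = 0) (hq' : q'.re = 0) (hh' : h'.re = 0) (cq : q * q' = q' * q)
    (ch : h * h' = h' * h) (cc : q * h' + h * q' = h' * q + q' * h)
    (cxy : star x * y = star y * x)
    (cx : x * (q' + h') + (h - q) * y = y * (q + h) + (h' - q') * x)
    (hind : LinearIndependent ℝ ![skewMk q h x, skewMk q' h' y]) :
    IsFlatPlane (Submodule.span ℝ {skewMk q h x, skewMk q' h' y}) := by
  by_cases x0 : x = 0
  · by_cases y0 : y = 0
    · subst x0 y0
      exact isFlatPlane_of_diagonal hq hh hq' hh' cq ch cc hind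
    · rw [Set.pair_comm]
      exact isFlatPlane_of_ne_zero_of_star_mul_comm hq' hh' hq hh cq.symm ch.symm
        (by rw [add_comm, ← cc, add_comm]) y0 cxy.symm
        (by rw [← cx]) (LinearIndependent.pair_symm_iff.1 hind)
  · exact isFlatPlane_of_ne_zero_of_star_mul_comm hq hh hq' hh' cq ch cc x0 cxy cx hind

theorem apply_of_conjTranspose_eq_neg {X : M2} (hX : Xᴴ = -X) :
    (X 0 0).re = 0 ∧ (X 1 1).re = 0 ∧ X 0 1 = -star (X 1 0) := by
  have e : ∀ i j, star (X j i) = -X i j := fun i j => by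
    rw [← Matrix.conjTranspose_apply, hX, Matrix.neg_apply]
  exact ⟨Quaternion.star_eq_neg.1 (e 0 0), Quaternion.star_eq_neg.1 (e 1 1), by rw [e 0 1, neg_neg]⟩

theorem tdX_eq_skewMk (t : ℝ) {X : M2} (hX : Xᴴ = -X) :
    tdX t X = skewMk ((X 0 0 - X 1 1) / 2) (t • ((X 0 0 + X 1 1) / 2)) (X 1 0) := by
  have e : (X 1 1 - X 0 0) / 2 = -((X 0 0 - X 1 1) / 2) := by rw [← neg_div, neg_sub]
  ext1 i j
  fin_cases i <;> fin_cases j <;>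
    simp [tdX, skewMk, Ppart, Kpart, Qpart, Hpart, dg, e, (apply_of_conjTranspose_eq_neg hX).2.2]
  abel

/-- Lemma 1 of the paper: a plane span{X̃,Ỹ} satisfying the five bracket
conditions (the zero-curvature planes of the twice Cheeger-contracted metric)
is spanned by a pair of matrices of type (12), (14) or (16). -/
theorem stmt4 (t : ℝ) (ht0 : 0 < t) (ht1 : t < 1)
    (X Y : M2) (hX : Xᴴ = -X) (hY : Yᴴ = -Y)
    (h1 : br (tdX t X) (tdX t Y) = 0)
    (h2 : br (tdK t X) (tdK t Y) = 0)
    (h3 : br (Ppart X) (Ppart Y) = 0)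
    (h4 : br (Qpart X) (Qpart Y) = 0)
    (h5 : br (Hpart X) (Hpart Y) = 0)
    (hind : LinearIndependent ℝ ![tdX t X, tdX t Y]) :
    ∃ x y : ℍ[ℝ], y.re = 0 ∧
      ((y ≠ 0 ∧
          Submodule.span ℝ {tdX t X, tdX t Y} =
            Submodule.span ℝ {dg y 0, dg 0 y}) ∨
       (x ≠ 0 ∧ y ≠ 0 ∧
          Submodule.span ℝ {tdX t X, tdX t Y} =
            Submodule.span ℝ {(!![0, -star x; x, 0] : M2), dg y (x * y * x⁻¹)}) ∨
       (∃ ε : ℝ, (ε = 1 ∨ ε = -1) ∧ x ≠ 0 ∧ y ≠ 0 ∧ x * y * x⁻¹ = ε • y ∧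
          Submodule.span ℝ {tdX t X, tdX t Y} =
            Submodule.span ℝ {(!![y, -star x; x, -(ε • y)] : M2), dg y (ε • y)})) := by
  obtain ⟨hX0, hX1, hXp⟩ := apply_of_conjTranspose_eq_neg hX
  obtain ⟨hY0, hY1, hYp⟩ := apply_of_conjTranspose_eq_neg hY
  have half_re : ∀ a : ℍ[ℝ], a.re = 0 → (a / 2).re = 0 := fun a ha => by
    have : CharZero ℍ[ℝ] := algebraRat.charZero _
    have : (2 : ℝ) • (a / 2) = a := by rw [two_smul, add_halves]
    simpa [ha] using congrArg QuaternionAlgebra.re this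
  have e5 := congrFun₂ h5 0 0
  have e4 := congrFun₂ h4 0 0
  have e2 := congrFun₂ h2 0 0
  have e3 := congrFun₂ h3 0 0
  rw [tdX_eq_skewMk t hX, tdX_eq_skewMk t hY] at hind h1 ⊢
  have e1 := congrFun₂ h1 1 0
  have qX := half_re (X 0 0 - X 1 1) (by simp [hX0, hX1])
  have qY := half_re (Y 0 0 - Y 1 1) (by simp [hY0, hY1])
  have hhX := half_re (X 0 0 + X 1 1) (by simp [hX0, hX1])
  have hhY := half_re (Y 0 0 + Y 1 1) (by simp [hY0, hY1])
  simp only [br, skewMk, tdK, Ppart, Kpart, Qpart, Hpart, dg, Matrix.sub_apply, Matrix.mul_apply,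
    Fin.sum_univ_two, Matrix.add_apply, Matrix.smul_apply, Matrix.zero_apply, Matrix.of_apply,
    Matrix.cons_val', Matrix.cons_val_zero, Matrix.cons_val_one, Matrix.cons_val_fin_one,
    hXp, hYp, sub_self, sub_zero, mul_zero, add_zero, zero_add, smul_zero]
    at e1 e2 e3 e4 e5
  generalize (X 0 0 - X 1 1) / 2 = q at *
  generalize (Y 0 0 - Y 1 1) / 2 = q' at *
  generalize (X 0 0 + X 1 1) / 2 = h at *
  generalize (Y 0 0 + Y 1 1) / 2 = h' at *
  refine isFlatPlane_of_commute qX (by simp [hhX]) qY (by simp [hhY]) (sub_eq_zero.1 e4) ?_ ?_ ?_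
    (sub_eq_zero.1 e1) hind
  · simp only [mul_smul_comm, smul_mul_assoc, sub_eq_zero.1 e5]
  · have : (q * q' - q' * q) + (t * t) • (h * h' - h' * h) = 0 := by rw [e4, e5]; simp
    rw [← sub_eq_zero, ← sub_eq_zero.2 (e2.trans this.symm)]
    simp only [mul_add, add_mul, mul_smul_comm, smul_mul_assoc]
    module
  · rw [neg_mul, neg_mul, sub_neg_eq_add, neg_add_eq_zero] at e3
    exact e3

end
end

section
/- Let g ∈ Sp(2), let 0 < s̃ < 1, and let y ∈ Im ℍ with y ≠ 0. Then the matrices diag(y,0) and diag(0,y) are not both horizontal at g. (Equivalently, writing (a,b) for the first row of g, one cannot have both a·y·ā = y and b·y·b̄ = y.) -/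
open scoped Quaternion
open Matrix

noncomputable section

/-- Real inner product on quaternions: ⟨x,y⟩ = Re(x̄·y). -/
def qip (x y : ℍ[ℝ]) : ℝ := (star x * y).re

/-- g ∈ Sp(2): g*·g = 1. -/
def Sp2 (g : M2) : Prop := gᴴ * g = 1

/-- ⟨A,B⟩ = Re trace(A*·B). -/
def mip (A B : M2) : ℝ := ((Aᴴ * B).trace).re

/-- ⟨A,B⟩₁ = ⟨A_p,B_p⟩ + s̃·⟨A_k,B_k⟩. -/
def mip1 (s : ℝ) (A B : M2) : ℝ := mip (Ppart A) (Ppart B) + s * mip (Kpart A) (Kpart B)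

/-- v_g = g⁻¹·diag(v,0)·g − diag(v,v)  (with g⁻¹ = gᴴ for g ∈ Sp(2)). -/
def vmat (g : M2) (v : ℍ[ℝ]) : M2 := gᴴ * dg v 0 * g - dg v v

/-- M is horizontal at g for the parameter s̃: ⟨M, v_g⟩₁ = 0 for all v ∈ Im ℍ. -/
def Horizontal (s : ℝ) (g M : M2) : Prop :=
  ∀ v : ℍ[ℝ], v.re = 0 → mip1 s M (vmat g v) = 0

/-- Ad(a) : v ↦ a·v·a⁻¹ as an ℝ-linear endomorphism of ℍ. -/
def Ad (a : ℍ[ℝ]) : ℍ[ℝ] →ₗ[ℝ] ℍ[ℝ] where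
  toFun v := a * v * a⁻¹
  map_add' u v := by simp [mul_add, add_mul]
  map_smul' r v := by simp [mul_smul_comm, smul_mul_assoc]

/-- D(a,b) = det(id − Ad(a⁻¹) − Ad(b⁻¹)) on ℍ. -/
def Dd (a b : ℍ[ℝ]) : ℝ := LinearMap.det (LinearMap.id - Ad a⁻¹ - Ad b⁻¹)

/-- Pairing a diagonal matrix with `vmat g v` only sees the diagonal blocks. -/
theorem mip1_dg_vmat (s : ℝ) (g : M2) (x y v : ℍ[ℝ]) :
    mip1 s (dg x y) (vmat g v) =
      s * ((star x * (star (g 0 0) * v * g 0 0 - v)).re +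
        (star y * (star (g 0 1) * v * g 0 1 - v)).re) := by
  simp [mip1, mip, Ppart, Kpart, vmat, dg, Matrix.trace_fin_two, Matrix.mul_apply,
    Fin.sum_univ_two, Matrix.conjTranspose_apply]

theorem one_le_norm_of_re_star_mul_conj_sub_eq_zero {a y : ℍ[ℝ]} (hy : y ≠ 0)
    (h : (star y * (star a * y * a - y)).re = 0) : 1 ≤ ‖a‖ := by
  have hpos : 0 < ‖y‖ := norm_pos_iff.mpr hy
  have hself : (star y * y).re = ‖y‖ * ‖y‖ := by
    rw [Quaternion.star_mul_self, Quaternion.re_coe, Quaternion.normSq_eq_norm_mul_self]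
  have hle : (star y * (star a * y * a)).re ≤ ‖y‖ * (‖a‖ * ‖y‖ * ‖a‖) := by
    have hre (q : ℍ[ℝ]) : q.re ≤ ‖q‖ := by
      have h2 : ‖q‖ * ‖q‖ = q.re ^ 2 + q.imI ^ 2 + q.imJ ^ 2 + q.imK ^ 2 := by
        rw [← Quaternion.normSq_eq_norm_mul_self, Quaternion.normSq_def']
      exact le_of_sq_le_sq (by nlinarith [sq_nonneg q.imI, sq_nonneg q.imJ, sq_nonneg q.imK])
        (norm_nonneg q)
    simpa only [norm_mul, norm_star] using hre (star y * (star a * y * a))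
  rw [mul_sub, Quaternion.re_sub, hself] at h
  have hsq : 1 ≤ ‖a‖ * ‖a‖ := by
    have : ‖y‖ * ‖y‖ * 1 ≤ ‖y‖ * ‖y‖ * (‖a‖ * ‖a‖) := by linarith
    exact le_of_mul_le_mul_left this (mul_pos hpos hpos)
  nlinarith [norm_nonneg a]

/-- In a unit column of quaternions whose first entry has norm at least one, the second entry
vanishes. -/
theorem eq_zero_of_star_mul_self_add_eq_one {a c : ℍ[ℝ]}
    (h : star a * a + star c * c = 1) (ha : 1 ≤ ‖a‖) : c = 0 := by
  have hre := congrArg (fun q : ℍ[ℝ] => q.re) h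
  simp only [Quaternion.star_mul_self, Quaternion.re_add, Quaternion.re_coe,
    Quaternion.normSq_eq_norm_mul_self, Quaternion.re_one] at hre
  exact norm_eq_zero.mp (by nlinarith [norm_nonneg c])

/-- Lemma 2 of the paper: a plane of type (12), spanned by diag(y,0) and
diag(0,y), is nowhere horizontal. -/
theorem stmt5 (s : ℝ) (hs0 : 0 < s) (hs1 : s < 1)
    (g : M2) (hg : Sp2 g) (y : ℍ[ℝ]) (hy : y.re = 0) (hy0 : y ≠ 0) :
    ¬(Horizontal s g (dg y 0) ∧ Horizontal s g (dg 0 y)) := by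
  rintro ⟨h1, h2⟩
  have ha : 1 ≤ ‖g 0 0‖ := by
    apply one_le_norm_of_re_star_mul_conj_sub_eq_zero hy0
    simpa [mip1_dg_vmat, hs0.ne'] using h1 y hy
  have hb : 1 ≤ ‖g 0 1‖ := by
    apply one_le_norm_of_re_star_mul_conj_sub_eq_zero hy0
    simpa [mip1_dg_vmat, hs0.ne'] using h2 y hy
  have hentry (i j : Fin 2) :
      star (g 0 i) * g 0 j + star (g 1 i) * g 1 j = (1 : M2) i j := by
    rw [← hg]
    simp [Matrix.mul_apply, Fin.sum_univ_two]
  have hc : g 1 0 = 0 :=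
    eq_zero_of_star_mul_self_add_eq_one (by simpa using hentry 0 0) ha
  have h01 := hentry 0 1
  simp only [hc, star_zero, zero_mul, add_zero, ne_eq, zero_ne_one, not_false_eq_true,
    Matrix.one_apply_ne, mul_eq_zero, star_eq_zero] at h01
  rcases h01 with h | h
  · norm_num [h] at ha
  · norm_num [h] at hb

end
end

section
/- Let g ∈ Sp(2) with first row (a,b) and let 0 < s̃ < 1. There exist x ∈ ℍ with x ≠ 0 and y ∈ Im ℍ with y ≠ 0 such that the matrix with rows (0, −x̄), (x, 0) and the matrix diag(y, x·y·x⁻¹) are both horizontal at g, if and only if at least one of the following holds: (i) a ≠ 0, b ≠ 0 and D(a,b) = 0; (ii) a = 0 and |Im b| ≥ 1/2; (iii) b = 0 and |Im a| ≥ 1/2. -/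
open scoped Quaternion
open Matrix

noncomputable section

lemma im_sq_sum_pos {y : ℍ[ℝ]} (hre : y.re = 0) (hy : y ≠ 0) :
    0 < y.imI ^ 2 + y.imJ ^ 2 + y.imK ^ 2 := by
  have h : 0 < Quaternion.normSq y := by
    rw [lt_iff_le_and_ne]
    exact ⟨Quaternion.normSq_nonneg, fun h => hy (Quaternion.normSq_eq_zero.1 h.symm)⟩
  rwa [Quaternion.normSq_def', hre, zero_pow two_ne_zero, zero_add] at h

lemma re_mul_eq_zero_iff_im (q : ℍ[ℝ]) :
    (∀ v : ℍ[ℝ], v.re = 0 → (q * v).re = 0) ↔ q.im = 0 := by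
  constructor
  · intro h
    by_contra hq
    have h1 := h q.im (Quaternion.re_im q)
    have h2 := im_sq_sum_pos (Quaternion.re_im q) hq
    simp only [Quaternion.re_mul, Quaternion.re_im, Quaternion.imI_im, Quaternion.imJ_im,
      Quaternion.imK_im] at h1 h2
    nlinarith
  · intro h v hv
    have hI := congrArg (fun p : ℍ[ℝ] => p.imI) h
    have hJ := congrArg (fun p : ℍ[ℝ] => p.imJ) h
    have hK := congrArg (fun p : ℍ[ℝ] => p.imK) h
    simp at hI hJ hK
    simp [Quaternion.re_mul, hv, hI, hJ, hK]

lemma horizontal_offDiag_iff (s : ℝ) (g : M2) (x : ℍ[ℝ]) :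
    Horizontal s g (!![0, -star x; x, 0] : M2) ↔ (g 0 0 * star x * star (g 0 1)).im = 0 := by
  rw [← re_mul_eq_zero_iff_im]
  refine forall₂_congr fun v hv => ?_
  have h : mip1 s (!![0, -star x; x, 0] : M2) (vmat g v) =
      2 * (g 0 0 * star x * star (g 0 1) * v).re := by
    simp [mip1, mip, vmat, Ppart, Kpart, dg, Matrix.trace, Matrix.mul_apply,
      Fin.sum_univ_two, Matrix.conjTranspose_apply, Quaternion.re_mul, Quaternion.imI_mul,
      Quaternion.imJ_mul, Quaternion.imK_mul, hv]
    ring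
  rw [h]
  simp

lemma horizontal_dg_iff {s : ℝ} (hs : s ≠ 0) (g : M2) {y z : ℍ[ℝ]} (hy : y.re = 0)
    (hz : z.re = 0) :
    Horizontal s g (dg y z) ↔
      g 0 0 * y * star (g 0 0) + g 0 1 * z * star (g 0 1) = y + z := by
  set q := g 0 0 * y * star (g 0 0) + g 0 1 * z * star (g 0 1) - (y + z) with hq
  have hqre : q.re = 0 := by
    simp [hq, Quaternion.re_mul, Quaternion.imI_mul, Quaternion.imJ_mul, Quaternion.imK_mul,
      hy, hz]
    ring
  have h0 : g 0 0 * y * star (g 0 0) + g 0 1 * z * star (g 0 1) = y + z ↔ q.im = 0 := by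
    rw [← sub_eq_zero, ← hq]
    constructor
    · intro h
      simp [h]
    · intro h
      rw [← Quaternion.re_add_im q, h, hqre]
      simp
  rw [h0, ← re_mul_eq_zero_iff_im]
  refine forall₂_congr fun v hv => ?_
  have h : mip1 s (dg y z) (vmat g v) = -s * (q * v).re := by
    simp [hq, mip1, mip, vmat, Ppart, Kpart, dg, Matrix.trace, Matrix.mul_apply,
      Fin.sum_univ_two, Matrix.conjTranspose_apply, Quaternion.re_mul, Quaternion.imI_mul,
      Quaternion.imJ_mul, Quaternion.imK_mul, hv, hy, hz]
    ring
  rw [h]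
  simp [hs]

lemma Sp2.normSq_row {g : M2} (hg : Sp2 g) :
    Quaternion.normSq (g 0 0) + Quaternion.normSq (g 0 1) = 1 := by
  have h : g * gᴴ = 1 := mul_eq_one_comm.1 hg
  have h2 := congrArg (fun m : M2 => (m 0 0).re) h
  simp only [Matrix.mul_apply, Fin.sum_univ_two, Matrix.conjTranspose_apply,
    Quaternion.self_mul_star] at h2
  simpa using h2

lemma exists_orthogonal (p : ℍ[ℝ]) :
    ∃ q : ℍ[ℝ], q.re = 0 ∧ p.imI * q.imI + p.imJ * q.imJ + p.imK * q.imK = 0 ∧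
      0 < q.imI ^ 2 + q.imJ ^ 2 + q.imK ^ 2 := by
  by_cases h : p.imI = 0
  · exact ⟨⟨0, 1, 0, 0⟩, rfl, by simp [h], by norm_num⟩
  · refine ⟨⟨0, p.imJ, -p.imI, 0⟩, rfl, by ring, ?_⟩
    have := pow_pos (abs_pos.2 h) 2
    rw [sq_abs] at this
    dsimp only
    nlinarith [sq_nonneg p.imJ]

lemma exists_conj_eq {y z : ℍ[ℝ]} (hy : y.re = 0) (hz : z.re = 0)
    (h : Quaternion.normSq y = Quaternion.normSq z) :
    ∃ x : ℍ[ℝ], x ≠ 0 ∧ x * y * x⁻¹ = z := by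
  suffices ∃ x : ℍ[ℝ], x ≠ 0 ∧ x * y = z * x by
    obtain ⟨x, hx, hxy⟩ := this
    exact ⟨x, hx, by rw [hxy, mul_inv_cancel_right₀ hx]⟩
  rw [Quaternion.normSq_def', Quaternion.normSq_def', hy, hz] at h
  by_cases hzy : z + y = 0
  · obtain ⟨q, hqre, hq, hq0⟩ := exists_orthogonal y
    obtain rfl := eq_neg_of_add_eq_zero_left hzy
    refine ⟨q, ?_, ?_⟩
    · rintro rfl
      simp at hq0
    · apply Quaternion.ext <;> simp [Quaternion.re_mul, Quaternion.imI_mul, Quaternion.imJ_mul,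
        Quaternion.imK_mul, hy, hqre] <;> linarith
  · refine ⟨z + y, hzy, ?_⟩
    apply Quaternion.ext <;> simp [Quaternion.re_mul, Quaternion.imI_mul, Quaternion.imJ_mul,
      Quaternion.imK_mul, hy, hz] <;> linarith

lemma norm_im_ge_half_iff (c : ℍ[ℝ]) :
    ‖c.im‖ ≥ 1 / 2 ↔ 1 ≤ 4 * (c.imI ^ 2 + c.imJ ^ 2 + c.imK ^ 2) := by
  have h : ‖c.im‖ * ‖c.im‖ = c.imI ^ 2 + c.imJ ^ 2 + c.imK ^ 2 := by
    rw [← Quaternion.normSq_eq_norm_mul_self, Quaternion.normSq_def']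
    simp
  rw [← h]
  constructor <;> intro h' <;> nlinarith [norm_nonneg c.im]

lemma normSq_conj_sub {c z : ℍ[ℝ]} (hc : Quaternion.normSq c = 1) (hz : z.re = 0) :
    Quaternion.normSq (c * z * star c - z) =
      4 * ((c.imI ^ 2 + c.imJ ^ 2 + c.imK ^ 2) * (z.imI ^ 2 + z.imJ ^ 2 + z.imK ^ 2) -
        (c.imI * z.imI + c.imJ * z.imJ + c.imK * z.imK) ^ 2) := by
  have hcc : star c * c = 1 := by rw [Quaternion.star_mul_self, hc]; simp
  have h : (c * z * star c - z) * c = c * z - z * c := by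
    rw [sub_mul, mul_assoc (c * z), hcc, mul_one]
  have h' : Quaternion.normSq (c * z * star c - z) = Quaternion.normSq (c * z - z * c) := by
    rw [← h, map_mul, hc, mul_one]
  rw [h', Quaternion.normSq_def']
  simp [Quaternion.re_mul, Quaternion.imI_mul, Quaternion.imJ_mul, Quaternion.imK_mul, hz]
  ring

lemma exists_normSq_conj_sub_eq_iff {c : ℍ[ℝ]} (hc : Quaternion.normSq c = 1) :
    (∃ z : ℍ[ℝ], z.re = 0 ∧ z ≠ 0 ∧
      Quaternion.normSq (c * z * star c - z) = Quaternion.normSq z) ↔ ‖c.im‖ ≥ 1 / 2 := by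
  rw [norm_im_ge_half_iff]
  constructor
  · rintro ⟨z, hz, hz0, h⟩
    have hpos := im_sq_sum_pos hz hz0
    rw [normSq_conj_sub hc hz, Quaternion.normSq_def' z, hz] at h
    refine le_of_mul_le_mul_right ?_ hpos
    nlinarith [sq_nonneg (c.imI * z.imI + c.imJ * z.imJ + c.imK * z.imK)]
  · intro h
    obtain ⟨q, hqre, hq, hq0⟩ := exists_orthogonal c
    set N := c.imI ^ 2 + c.imJ ^ 2 + c.imK ^ 2 with hN
    set Q := q.imI ^ 2 + q.imJ ^ 2 + q.imK ^ 2 with hQ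
    have hNpos : 0 < N := by linarith
    obtain ⟨t, ht⟩ : ∃ t : ℝ, t ^ 2 * N = (4 * N - 1) * Q := by
      refine ⟨√((4 * N - 1) * Q / N), ?_⟩
      have h1 : 0 ≤ 4 * N - 1 := by linarith
      rw [Real.sq_sqrt (by positivity), div_mul_cancel₀ _ hNpos.ne']
    obtain ⟨z, hz⟩ : ∃ z : ℍ[ℝ], z = t • c.im + q := ⟨_, rfl⟩
    have hzre : z.re = 0 := by simp [hz, hqre]
    have hzz : z.imI ^ 2 + z.imJ ^ 2 + z.imK ^ 2 = t ^ 2 * N + Q := by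
      simp [hz, hN, hQ]
      linear_combination 2 * t * hq
    have hcz : c.imI * z.imI + c.imJ * z.imJ + c.imK * z.imK = t * N := by
      simp [hz, hN]
      linear_combination hq
    refine ⟨z, hzre, ?_, ?_⟩
    · rintro rfl
      simp at hzz
      nlinarith [mul_nonneg (sq_nonneg t) hNpos.le]
    · rw [normSq_conj_sub hc hzre, Quaternion.normSq_def' z, hzre, zero_pow two_ne_zero, zero_add,
        hzz, hcz, ← hN]
      linear_combination -ht

lemma re_conj (x y : ℍ[ℝ]) (hy : y.re = 0) : (x * y * x⁻¹).re = 0 := by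
  rw [Quaternion.inv_def, mul_smul_comm, Quaternion.re_smul]
  refine mul_eq_zero_of_right _ ?_
  simp [Quaternion.re_mul, Quaternion.imI_mul, Quaternion.imJ_mul, Quaternion.imK_mul, hy]
  ring

lemma normSq_conj {x : ℍ[ℝ]} (hx : x ≠ 0) (y : ℍ[ℝ]) :
    Quaternion.normSq (x * y * x⁻¹) = Quaternion.normSq y := by
  have h : Quaternion.normSq x ≠ 0 := Quaternion.normSq_ne_zero.2 hx
  rw [map_mul, map_mul, map_inv₀]
  field_simp

lemma mul_mul_star_eq_normSq_smul {a : ℍ[ℝ]} (ha : a ≠ 0) (y : ℍ[ℝ]) :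
    a * y * star a = Quaternion.normSq a • (a * y * a⁻¹) := by
  rw [Quaternion.inv_def, mul_smul_comm, smul_smul,
    mul_inv_cancel₀ (Quaternion.normSq_ne_zero.2 ha), one_smul]

lemma Dd_eq_zero_iff (a b : ℍ[ℝ]) :
    Dd a b = 0 ↔ ∃ w : ℍ[ℝ], w ≠ 0 ∧ a⁻¹ * w * a + b⁻¹ * w * b = w := by
  rw [Dd, LinearMap.det_eq_zero_iff_ker_ne_bot, Submodule.ne_bot_iff]
  refine exists_congr fun w => ?_
  have : w ∈ LinearMap.ker (LinearMap.id - Ad a⁻¹ - Ad b⁻¹) ↔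
      a⁻¹ * w * a + b⁻¹ * w * b = w := by
    simp only [LinearMap.mem_ker, LinearMap.sub_apply, LinearMap.id_apply, Ad,
      inv_inv, sub_sub, sub_eq_zero]
    exact eq_comm
  rw [this, and_comm]

lemma re_eq_zero_of_conj_add_conj_eq {a b w : ℍ[ℝ]} (ha : a ≠ 0) (hb : b ≠ 0)
    (h : a⁻¹ * w * a + b⁻¹ * w * b = w) : w.re = 0 := by
  have key : ∀ c : ℍ[ℝ], c ≠ 0 → (c⁻¹ * w * c).re = w.re := by
    intro c hc
    have h1 := re_conj c⁻¹ w.im (Quaternion.re_im w)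
    rw [inv_inv] at h1
    have h2 : c⁻¹ * w * c = (w.re : ℍ[ℝ]) + c⁻¹ * w.im * c := by
      conv_lhs => rw [← Quaternion.re_add_im w]
      rw [mul_add, add_mul, ← Quaternion.coe_commutes, mul_assoc, inv_mul_cancel₀ hc, mul_one]
    rw [h2, Quaternion.re_add, h1, Quaternion.re_coe, add_zero]
  have h1 := congrArg (fun q : ℍ[ℝ] => q.re) h
  simp only [Quaternion.re_add, key a ha, key b hb] at h1
  linarith

lemma im_mul_star_mul_star_eq_zero_iff {a b x : ℍ[ℝ]} (ha : a ≠ 0) (hb : b ≠ 0) :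
    (a * star x * star b).im = 0 ↔ ∃ r : ℝ, x = r • (b⁻¹ * a) := by
  have ha' : Quaternion.normSq a ≠ 0 := Quaternion.normSq_ne_zero.2 ha
  have hstar : star a * a = ((Quaternion.normSq a : ℝ) : ℍ[ℝ]) := Quaternion.star_mul_self a
  constructor
  · intro h
    have h1 : a * star x * star b = ((a * star x * star b).re : ℍ[ℝ]) := by
      conv_lhs => rw [← Quaternion.re_add_im (a * star x * star b), h, add_zero]
    set r := (a * star x * star b).re
    have h2 : b * x * star a = (r : ℍ[ℝ]) := by
      have := congrArg star h1
      simpa [mul_assoc] using this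
    refine ⟨r / Quaternion.normSq a, ?_⟩
    have h3 : b * x * (star a * a) = r • a := by
      rw [← mul_assoc, h2, Quaternion.coe_mul_eq_smul]
    rw [hstar, Quaternion.mul_coe_eq_smul] at h3
    rw [← mul_smul_comm, div_eq_inv_mul, ← smul_smul, ← h3, smul_smul, inv_mul_cancel₀ ha',
      one_smul, inv_mul_cancel_left₀ hb]
  · rintro ⟨r, rfl⟩
    have h : star (a * star (r • (b⁻¹ * a)) * star b) =
        ((r * Quaternion.normSq a : ℝ) : ℍ[ℝ]) := by
      simp only [star_mul, star_star, mul_smul_comm, smul_mul_assoc]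
      rw [mul_assoc, Quaternion.self_mul_star, mul_inv_cancel_left₀ hb, Quaternion.coe_mul,
        Quaternion.coe_mul_eq_smul]
    rw [← star_star (a * star (r • (b⁻¹ * a)) * star b), h, Quaternion.star_coe,
      Quaternion.im_coe]

lemma exists_horizontal_iff_of_ne_zero {a b : ℍ[ℝ]} (ha : a ≠ 0) (hb : b ≠ 0)
    (hab : Quaternion.normSq a + Quaternion.normSq b = 1) :
    (∃ x y : ℍ[ℝ], x ≠ 0 ∧ y.re = 0 ∧ y ≠ 0 ∧ (a * star x * star b).im = 0 ∧
        a * y * star a + b * (x * y * x⁻¹) * star b = y + x * y * x⁻¹) ↔ Dd a b = 0 := by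
  rw [Dd_eq_zero_iff]
  have key : ∀ (r : ℝ) (y : ℍ[ℝ]), r ≠ 0 →
      (a * y * star a + b * ((r • (b⁻¹ * a)) * y * (r • (b⁻¹ * a))⁻¹) * star b =
        y + (r • (b⁻¹ * a)) * y * (r • (b⁻¹ * a))⁻¹ ↔
      a⁻¹ * (a * y * a⁻¹) * a + b⁻¹ * (a * y * a⁻¹) * b = a * y * a⁻¹) := by
    intro r y hr
    have h1 : (r • (b⁻¹ * a)) * y * (r • (b⁻¹ * a))⁻¹ = b⁻¹ * (a * y * a⁻¹) * b := by
      rw [smul_inv₀, smul_mul_assoc, smul_mul_assoc, mul_smul_comm, smul_smul,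
        mul_inv_cancel₀ hr, one_smul, _root_.mul_inv_rev, inv_inv]
      simp only [mul_assoc]
    have h2 : b * (b⁻¹ * (a * y * a⁻¹) * b) * b⁻¹ = a * y * a⁻¹ := by
      simp [mul_assoc, hb]
    have h3 : a⁻¹ * (a * y * a⁻¹) * a = y := by simp [mul_assoc, ha]
    rw [h1, mul_mul_star_eq_normSq_smul ha, mul_mul_star_eq_normSq_smul hb, h2, h3, ← add_smul,
      hab, one_smul]
    exact eq_comm
  constructor
  · rintro ⟨x, y, hx, -, hy, hxab, h⟩
    obtain ⟨r, rfl⟩ := (im_mul_star_mul_star_eq_zero_iff ha hb).1 hxab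
    have hr : r ≠ 0 := left_ne_zero_of_smul hx
    exact ⟨a * y * a⁻¹, by simp [ha, hy], (key r y hr).1 h⟩
  · rintro ⟨w, hw, h⟩
    have hwre := re_eq_zero_of_conj_add_conj_eq ha hb h
    have hwy : a * (a⁻¹ * w * a) * a⁻¹ = w := by simp [mul_assoc, ha]
    refine ⟨(1 : ℝ) • (b⁻¹ * a), a⁻¹ * w * a, by simp [ha, hb], ?_, by simp [ha, hw],
      (im_mul_star_mul_star_eq_zero_iff ha hb).2 ⟨1, rfl⟩, ?_⟩
    · simpa using re_conj a⁻¹ w hwre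
    · rw [key 1 _ one_ne_zero, hwy, h]

lemma exists_horizontal_iff_of_right_eq_zero {a : ℍ[ℝ]} (ha : Quaternion.normSq a = 1) :
    (∃ x y : ℍ[ℝ], x ≠ 0 ∧ y.re = 0 ∧ y ≠ 0 ∧ a * y * star a = y + x * y * x⁻¹) ↔
      ‖a.im‖ ≥ 1 / 2 := by
  rw [← exists_normSq_conj_sub_eq_iff ha]
  constructor
  · rintro ⟨x, y, hx, hy, hy0, h⟩
    exact ⟨y, hy, hy0, by rw [h, add_sub_cancel_left, normSq_conj hx]⟩
  · rintro ⟨y, hy, hy0, h⟩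
    have hre : (a * y * star a - y).re = 0 := by
      simp [Quaternion.re_mul, Quaternion.imI_mul, Quaternion.imJ_mul, Quaternion.imK_mul, hy]
      ring
    obtain ⟨x, hx, hxy⟩ := exists_conj_eq hy hre h.symm
    exact ⟨x, y, hx, hy, hy0, by rw [hxy, add_sub_cancel]⟩

lemma exists_horizontal_iff_of_left_eq_zero {b : ℍ[ℝ]} (hb : Quaternion.normSq b = 1) :
    (∃ x y : ℍ[ℝ], x ≠ 0 ∧ y.re = 0 ∧ y ≠ 0 ∧
        b * (x * y * x⁻¹) * star b = y + x * y * x⁻¹) ↔ ‖b.im‖ ≥ 1 / 2 := by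
  rw [← exists_horizontal_iff_of_right_eq_zero hb]
  constructor
  · rintro ⟨x, y, hx, hy, hy0, h⟩
    refine ⟨x⁻¹, x * y * x⁻¹, inv_ne_zero hx, re_conj x y hy, by simp [hx, hy0], ?_⟩
    rw [h, add_comm]
    simp [mul_assoc, hx]
  · rintro ⟨x, y, hx, hy, hy0, h⟩
    refine ⟨x⁻¹, x * y * x⁻¹, inv_ne_zero hx, re_conj x y hy, by simp [hx, hy0], ?_⟩
    have hxy : x⁻¹ * (x * y * x⁻¹) * x⁻¹⁻¹ = y := by simp [mul_assoc, hx]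
    rw [hxy, h, add_comm]

/-- Lemma 4 of the paper: existence of a horizontal plane of type (14) at
g ∈ Sp(2) with first row (a,b) is equivalent to (i) a,b ≠ 0 and
det(id − Ad(a⁻¹) − Ad(b⁻¹)) = 0, or (ii) a = 0 and |Im b| ≥ 1/2, or
(iii) b = 0 and |Im a| ≥ 1/2. -/
theorem stmt7 (s : ℝ) (hs0 : 0 < s) (hs1 : s < 1)
    (g : M2) (hg : Sp2 g) (a b : ℍ[ℝ]) (ha : a = g 0 0) (hb : b = g 0 1) :
    (∃ x y : ℍ[ℝ], x ≠ 0 ∧ y.re = 0 ∧ y ≠ 0 ∧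
        Horizontal s g (!![0, -star x; x, 0] : M2) ∧
        Horizontal s g (dg y (x * y * x⁻¹))) ↔
      ((a ≠ 0 ∧ b ≠ 0 ∧ Dd a b = 0) ∨
       (a = 0 ∧ ‖b.im‖ ≥ 1 / 2) ∨
       (b = 0 ∧ ‖a.im‖ ≥ 1 / 2)) := by
  have hrow := hg.normSq_row
  rw [← ha, ← hb] at hrow
  have hred : (∃ x y : ℍ[ℝ], x ≠ 0 ∧ y.re = 0 ∧ y ≠ 0 ∧
        Horizontal s g (!![0, -star x; x, 0] : M2) ∧ Horizontal s g (dg y (x * y * x⁻¹))) ↔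
      ∃ x y : ℍ[ℝ], x ≠ 0 ∧ y.re = 0 ∧ y ≠ 0 ∧ (a * star x * star b).im = 0 ∧
        a * y * star a + b * (x * y * x⁻¹) * star b = y + x * y * x⁻¹ := by
    refine exists₂_congr fun x y => and_congr_right fun _ => and_congr_right fun hy =>
      and_congr_right fun _ => ?_
    rw [horizontal_offDiag_iff, horizontal_dg_iff hs0.ne' g hy (re_conj x y hy), ha, hb]
  rw [hred]
  clear hred ha hb
  by_cases ha0 : a = 0
  · subst ha0
    have hb1 : Quaternion.normSq b = 1 := by simpa using hrow
    have hb0 : b ≠ 0 := by rintro rfl; simp at hb1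
    simpa [hb0] using exists_horizontal_iff_of_left_eq_zero hb1
  by_cases hb0 : b = 0
  · subst hb0
    have ha1 : Quaternion.normSq a = 1 := by simpa using hrow
    simpa [ha0] using exists_horizontal_iff_of_right_eq_zero ha1
  simpa [ha0, hb0] using exists_horizontal_iff_of_ne_zero ha0 hb0 hrow

end
end

section
/- Let a ∈ ℍ with |a| = 1. There exist x ∈ ℍ with x ≠ 0 and y ∈ Im ℍ with y ≠ 0 such that a·y·a⁻¹ − y = x·y·x⁻¹, if and only if |Im a| ≥ 1/2. -/
open scoped Quaternion

/-- A nonzero vector of `ℝ³` orthogonal to a given one. -/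
lemma exists_orthogonal_ne_zero (b c d : ℝ) :
    ∃ e f g : ℝ, b * e + c * f + d * g = 0 ∧ 0 < e ^ 2 + f ^ 2 + g ^ 2 := by
  by_cases h : b = 0
  · exact ⟨1, 0, 0, by simp [h], by norm_num⟩
  · exact ⟨-c, b, 0, by ring, by positivity⟩

/-- If `|v| ≥ 1/2`, some nonzero `y` satisfies `4 |v × y|² = |y|²`. -/
lemma exists_four_mul_cross_sq_eq (b c d : ℝ) (h : 1 / 4 ≤ b ^ 2 + c ^ 2 + d ^ 2) :
    ∃ e f g : ℝ, 0 < e ^ 2 + f ^ 2 + g ^ 2 ∧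
      4 * ((b ^ 2 + c ^ 2 + d ^ 2) * (e ^ 2 + f ^ 2 + g ^ 2) - (b * e + c * f + d * g) ^ 2) =
        e ^ 2 + f ^ 2 + g ^ 2 := by
  obtain ⟨e, f, g, ho, hn⟩ := exists_orthogonal_ne_zero b c d
  obtain ⟨S, hS⟩ : ∃ S, S = b ^ 2 + c ^ 2 + d ^ 2 := ⟨_, rfl⟩
  obtain ⟨n, hn'⟩ : ∃ n, n = e ^ 2 + f ^ 2 + g ^ 2 := ⟨_, rfl⟩
  rw [← hS] at h ⊢
  rw [← hn'] at hn
  have hp : √(n * (4 * S - 1)) ^ 2 = n * (4 * S - 1) :=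
    Real.sq_sqrt (mul_nonneg hn.le (by linarith))
  have hq : √S ^ 2 = S := Real.sq_sqrt (by linarith)
  set p := √(n * (4 * S - 1))
  set q := √S
  have hy : (p * b + q * e) ^ 2 + (p * c + q * f) ^ 2 + (p * d + q * g) ^ 2 = 4 * S ^ 2 * n := by
    linear_combination 2 * p * q * ho + S * hp + n * hq - p ^ 2 * hS - q ^ 2 * hn'
  have hi : b * (p * b + q * e) + c * (p * c + q * f) + d * (p * d + q * g) = p * S := by
    linear_combination q * ho - p * hS
  refine ⟨p * b + q * e, p * c + q * f, p * d + q * g, ?_, ?_⟩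
  · rw [hy]
    have : 0 < S := by linarith
    positivity
  · rw [hy, hi]
    linear_combination -4 * S ^ 2 * hp

/-- Equation (23) in the proof of Lemma 4 of the paper: for a unit quaternion
a, the equation a·y·a⁻¹ − y = x·y·x⁻¹ has a solution with x ≠ 0 and
0 ≠ y ∈ Im ℍ iff |Im a| ≥ 1/2. -/
theorem stmt8 (a : ℍ[ℝ]) (ha : ‖a‖ = 1) :
    (∃ x y : ℍ[ℝ], x ≠ 0 ∧ y.re = 0 ∧ y ≠ 0 ∧
        a * y * a⁻¹ - y = x * y * x⁻¹) ↔ ‖a.im‖ ≥ 1 / 2 := by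
  have ha0 : a ≠ 0 := by
    rintro rfl
    simp at ha
  constructor
  · rintro ⟨x, y, hx, -, hy, h⟩
    have hx' : ‖x‖ ≠ 0 := norm_ne_zero_iff.2 hx
    have hcomm : a.im * y - y * a.im = (a * y * a⁻¹ - y) * a := by
      rw [sub_mul, inv_mul_cancel_right₀ ha0]
      ext <;> simp <;> ring
    have hnorm : ‖a.im * y - y * a.im‖ = ‖y‖ := by
      rw [hcomm, h, norm_mul, norm_mul, norm_mul, norm_inv, ha]
      field_simp
    have hle := norm_sub_le (a.im * y) (y * a.im)
    rw [hnorm, norm_mul, norm_mul] at hle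
    have hy' : 0 < ‖y‖ := norm_pos_iff.2 hy
    nlinarith
  · intro h
    have hN : a.re ^ 2 + a.imI ^ 2 + a.imJ ^ 2 + a.imK ^ 2 = 1 := by
      rw [← Quaternion.normSq_def', Quaternion.normSq_eq_norm_mul_self, ha, one_mul]
    have hS : 1 / 4 ≤ a.imI ^ 2 + a.imJ ^ 2 + a.imK ^ 2 := by
      have him : ‖a.im‖ * ‖a.im‖ = a.imI ^ 2 + a.imJ ^ 2 + a.imK ^ 2 := by
        rw [← Quaternion.normSq_eq_norm_mul_self, Quaternion.normSq_def']
        simp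
      nlinarith
    have hinv : a⁻¹ = star a := by
      rw [Quaternion.inv_def, Quaternion.normSq_eq_norm_mul_self, ha]
      simp
    obtain ⟨e, f, g, hpos, hc⟩ := exists_four_mul_cross_sq_eq _ _ _ hS
    obtain ⟨y, hre, rfl, rfl, rfl⟩ :
        ∃ y : ℍ[ℝ], y.re = 0 ∧ y.imI = e ∧ y.imJ = f ∧ y.imK = g := ⟨⟨0, e, f, g⟩, rfl, rfl, rfl, rfl⟩
    have hy : y ≠ 0 := by
      rintro rfl
      simp at hpos
    have hw : a * y * a⁻¹ ≠ 0 := mul_ne_zero (mul_ne_zero ha0 hy) (inv_ne_zero ha0)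
    refine ⟨a * y * a⁻¹, y, hw, hre, hy, ?_⟩
    rw [eq_mul_inv_iff_mul_eq₀ hw, hinv]
    ext
    · simp [hre]
      linear_combination -hc - (y.imI ^ 2 + y.imJ ^ 2 + y.imK ^ 2) *
        (a.re ^ 2 + a.imI ^ 2 + a.imJ ^ 2 + a.imK ^ 2 - 1) * hN
    all_goals simp [hre]; ring
end

section
/- Let 0 < s̃ < 1 and let g ∈ Sp(2) with first row (a,b) such that |a| = |b| = 1/√2, |Im a| ≥ |a|/2, and ⟨w − 2·a⁻¹·w·a, w⟩ = 0, where w = Im(a⁻¹·b). Then there exist x, y ∈ Im ℍ, both nonzero, with ⟨x, y⟩ = 0 (equivalently x·y·x⁻¹ = −y), such that the matrices Y = diag(y, −y) and X with rows (y, x), (x, y) are both horizontal at g (for the parameter s̃). -/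
open scoped Quaternion
open Matrix

noncomputable section

theorem qip_eq (x y : ℍ[ℝ]) :
    qip x y = x.re * y.re + x.imI * y.imI + x.imJ * y.imJ + x.imK * y.imK := by
  simp [qip]

/-- The pairing of `diag(y, -y)` with `v_g` depends only on the first row of `g`. -/
theorem mip1_dg_neg_vmat (s : ℝ) (g : M2) (y v : ℍ[ℝ]) :
    mip1 s (dg y (-y)) (vmat g v) =
      s * qip (g 0 0 * y * star (g 0 0) - g 0 1 * y * star (g 0 1)) v := by
  simp [mip1, mip, Ppart, Kpart, dg, vmat, Matrix.trace_fin_two, Matrix.mul_apply,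
    Fin.sum_univ_two, qip_eq, -mul_eq_mul_left_iff]
  ring

/-- The pairing of the matrix with rows `(y, x)`, `(x, y)` with `v_g`. -/
theorem mip1_symm_vmat (s : ℝ) (g : M2) (x y v : ℍ[ℝ]) :
    mip1 s (!![y, x; x, y] : M2) (vmat g v) =
      qip (g 0 0 * x * star (g 0 1) + g 0 1 * x * star (g 0 0)
        + s • (g 0 0 * y * star (g 0 0) + g 0 1 * y * star (g 0 1) - 2 * y)) v := by
  simp [mip1, mip, Ppart, Kpart, dg, vmat, Matrix.trace_fin_two, Matrix.mul_apply,
    Fin.sum_univ_two, qip_eq, two_mul]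
  ring

theorem mul_eq_neg_mul_of_qip_eq_zero {x y : ℍ[ℝ]} (hx : x.re = 0) (hy : y.re = 0)
    (h : qip x y = 0) : x * y = -(y * x) := by
  rw [qip_eq] at h
  ext <;> simp [hx, hy] at h ⊢ <;> linarith

/-- An imaginary vector orthogonal to a given one. -/
theorem exists_imaginary_orthogonal (p q r : ℝ) :
    ∃ l m n : ℝ, p * l + q * m + r * n = 0 ∧ 0 < l ^ 2 + m ^ 2 + n ^ 2 := by
  by_cases h : p ^ 2 + q ^ 2 = 0
  · have hp : p = 0 := by nlinarith [sq_nonneg p, sq_nonneg q]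
    exact ⟨1, 0, 0, by simp [hp, show q = 0 by nlinarith [sq_nonneg p, sq_nonneg q]], by norm_num⟩
  · exact ⟨q, -p, 0, by ring, by
      have := lt_of_le_of_ne (by positivity : 0 ≤ p ^ 2 + q ^ 2) (Ne.symm h)
      linarith⟩

/-- If `|a|² = 1/2` and `|Im a|² ≥ 1/8`, some imaginary vector is turned by `π/3` by
conjugation with `a`. -/
theorem exists_qip_conj_eq_zero {a : ℍ[ℝ]} (ha : Quaternion.normSq a = 1 / 2)
    (hIm : 1 / 8 ≤ Quaternion.normSq a.im) :
    ∃ y : ℍ[ℝ], y.re = 0 ∧ y ≠ 0 ∧ qip (4 * (star a * y * a) - y) y = 0 := by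
  rw [Quaternion.normSq_def'] at ha hIm
  simp only [Quaternion.re_im, Quaternion.imI_im, Quaternion.imJ_im, Quaternion.imK_im] at hIm
  obtain ⟨l, m, n, horth, hpos⟩ := exists_imaginary_orthogonal a.imI a.imJ a.imK
  obtain ⟨N, hN⟩ : ∃ N, N = a.imI ^ 2 + a.imJ ^ 2 + a.imK ^ 2 := ⟨_, rfl⟩
  obtain ⟨M, hM⟩ : ∃ M, M = l ^ 2 + m ^ 2 + n ^ 2 := ⟨_, rfl⟩
  rw [← hM] at hpos
  have hN8 : 1 / 8 ≤ N := by linarith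
  obtain ⟨t, ht⟩ : ∃ t : ℝ, t ^ 2 * N = M * (8 * N - 1) := by
    refine ⟨√(M * (8 * N - 1) / N), ?_⟩
    rw [Real.sq_sqrt (div_nonneg (mul_nonneg hpos.le (by linarith)) (by linarith))]
    field_simp
  obtain ⟨y, hre, hI, hJ, hK⟩ : ∃ y : ℍ[ℝ], y.re = 0 ∧ y.imI = t * a.imI + l ∧
      y.imJ = t * a.imJ + m ∧ y.imK = t * a.imK + n := ⟨⟨0, _, _, _⟩, rfl, rfl, rfl, rfl⟩
  refine ⟨y, hre, fun h => ?_, ?_⟩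
  · rw [h] at hI hJ hK
    simp only [Quaternion.imI_zero, Quaternion.imJ_zero, Quaternion.imK_zero] at hI hJ hK
    have : M = 0 := by rw [hM]; linear_combination -l * hI - m * hJ - n * hK - t * horth
    linarith
  · have ha0 : a.re ^ 2 = 1 / 2 - N := by linarith
    have h4 : (4 : ℍ[ℝ]) = ((4 : ℝ) : ℍ[ℝ]) := by norm_cast
    rw [h4, Quaternion.coe_mul_eq_smul, qip_eq]
    simp only [Quaternion.re_sub, Quaternion.imI_sub, Quaternion.imJ_sub, Quaternion.imK_sub,
      Quaternion.re_smul, Quaternion.imI_smul, Quaternion.imJ_smul, Quaternion.imK_smul,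
      Quaternion.re_mul, Quaternion.imI_mul, Quaternion.imJ_mul, Quaternion.imK_mul,
      Quaternion.re_star, Quaternion.imI_star, Quaternion.imJ_star, Quaternion.imK_star,
      hre, hI, hJ, hK, smul_eq_mul]
    subst hN hM
    linear_combination 4 * ((t * a.imI + l) ^ 2 + (t * a.imJ + m) ^ 2 + (t * a.imK + n) ^ 2) * ha0
      + ht + (2 * t + 8 * (a.imI * l + a.imJ * m + a.imK * n)) * horth

theorem exists_horizontal_pair {s : ℝ} (hs : s ≠ 0) (g : M2) {u y : ℍ[ℝ]} {c t : ℝ}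
    (ha : g 0 0 * star (g 0 0) = ((1 / 2 : ℝ) : ℍ[ℝ])) (hb : g 0 1 = g 0 0 * u)
    (hu : u = c + t • y) (huu : u * star u = 1)
    (hy : y.re = 0) (hy0 : y ≠ 0)
    (h : qip (4 * (star (g 0 0) * y * g 0 0) - y) y = 0) :
    ∃ x y : ℍ[ℝ], x.re = 0 ∧ y.re = 0 ∧ x ≠ 0 ∧ y ≠ 0 ∧ qip x y = 0 ∧
      Horizontal s g (dg y (-y)) ∧ Horizontal s g (!![y, x; x, y] : M2) := by
  set a := g 0 0 with ha'
  set R := 4 * (star a * y * a) - y with hR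
  have h4 : (4 : ℍ[ℝ]) = ((4 : ℝ) : ℍ[ℝ]) := by norm_cast
  have hRre : R.re = 0 := by
    rw [hR, h4, Quaternion.coe_mul_eq_smul]
    simp [hy]; ring
  have haRa : a * R * star a = y - a * y * star a := by
    calc a * R * star a = 4 * ((a * star a) * y * (a * star a)) - a * y * star a := by
          rw [hR, h4]
          simp only [Quaternion.coe_mul_eq_smul, mul_sub, sub_mul, mul_smul_comm, smul_mul_assoc,
            mul_assoc]
      _ = y - a * y * star a := by
          rw [ha, h4]
          simp only [Quaternion.coe_mul_eq_smul, Quaternion.mul_coe_eq_smul, smul_smul]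
          norm_num
  have hRy : R * y = -(y * R) := mul_eq_neg_mul_of_qip_eq_zero hRre hy h
  have hystar : star y = -y := Quaternion.star_eq_neg.2 hy
  have hustar : star u = c - t • y := by
    rw [hu]; simp [hystar, sub_eq_add_neg]
  have hRu : star u * R = R * u := by
    rw [hustar, hu, sub_mul, mul_add, smul_mul_assoc, mul_smul_comm, hRy,
      Quaternion.coe_commutes, smul_neg, sub_eq_add_neg]
  have hyu : u * y * star u = y := by
    have : u * y = y * u := by
      rw [hu, add_mul, mul_add, smul_mul_assoc, mul_smul_comm, Quaternion.coe_commutes]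
    rw [this, mul_assoc, huu, mul_one]
  have hR0 : R ≠ 0 := by
    intro h0
    have h1 : y = a * y * star a := by
      rw [h0, mul_zero, zero_mul] at haRa
      exact sub_eq_zero.1 haRa.symm
    have h2 := congrArg Quaternion.normSq h1
    have h3 : Quaternion.normSq a = 1 / 2 := by
      rw [Quaternion.self_mul_star] at ha
      exact Quaternion.coe_injective ha
    rw [map_mul, map_mul, Quaternion.normSq_star, h3] at h2
    exact hy0 (Quaternion.normSq_eq_zero.1 (by linarith))
  rw [qip_eq, hRre, hy] at h
  refine ⟨s • (star u * R), y, ?_, hy, ?_, hy0, ?_, ?_, ?_⟩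
  · rw [hustar]
    simp [hRre, hy]
    right
    linear_combination t * h
  · refine smul_ne_zero hs (mul_ne_zero ?_ hR0)
    intro h0
    rw [h0, mul_zero] at huu
    exact zero_ne_one huu
  · rw [hustar, qip_eq]
    simp [hRre, hy]
    linear_combination s * c * h
  · intro v _
    have : g 0 1 * y * star (g 0 1) = a * y * star a := by
      rw [hb, star_mul]
      calc a * u * y * (star u * star a) = a * (u * y * star u) * star a := by
            simp only [mul_assoc]
        _ = _ := by rw [hyu]
    rw [mip1_dg_neg_vmat, this]
    simp [qip_eq, ← ha']
  · intro v _
    rw [mip1_symm_vmat]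
    suffices hz : g 0 0 * (s • (star u * R)) * star (g 0 1)
        + g 0 1 * (s • (star u * R)) * star (g 0 0)
        + s • (g 0 0 * y * star (g 0 0) + g 0 1 * y * star (g 0 1) - 2 * y) = 0 by
      rw [hz]; simp [qip_eq]
    have e1 : a * (star u * R) * (star u * star a) = a * R * star a := by
      calc a * (star u * R) * (star u * star a) = a * (R * (u * star u)) * star a := by
            rw [hRu]; simp only [mul_assoc]
        _ = _ := by rw [huu, mul_one]
    have e2 : a * u * (star u * R) * star a = a * R * star a := by
      calc a * u * (star u * R) * star a = a * ((u * star u) * R) * star a := by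
            simp only [mul_assoc]
        _ = _ := by rw [huu, one_mul]
    have e3 : a * u * y * (star u * star a) = a * y * star a := by
      calc a * u * y * (star u * star a) = a * (u * y * star u) * star a := by
            simp only [mul_assoc]
        _ = _ := by rw [hyu]
    rw [← ha', hb, star_mul, mul_smul_comm, mul_smul_comm, smul_mul_assoc, smul_mul_assoc,
      e1, e2, e3, haRa, ← smul_add, ← smul_add]
    rw [show y - a * y * star a + (y - a * y * star a) +
      (a * y * star a + a * y * star a - 2 * y) = 0 by rw [two_mul]; abel, smul_zero]

/-- The final Lemma of the paper (converse to Lemma 5): if g ∈ Sp(2) has first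
row (a,b) with |a| = |b| = 1/√2, |Im a| ≥ |a|/2 and ⟨w − 2a⁻¹wa, w⟩ = 0 for
w = Im(a⁻¹b), then there is a horizontal plane of type (16) at g. -/
theorem stmt15 (s : ℝ) (hs0 : 0 < s) (hs1 : s < 1)
    (g : M2) (hg : Sp2 g) (a b : ℍ[ℝ]) (ha : a = g 0 0) (hb : b = g 0 1)
    (hna : ‖a‖ = 1 / Real.sqrt 2) (hnb : ‖b‖ = 1 / Real.sqrt 2)
    (hIm : ‖a.im‖ ≥ ‖a‖ / 2)
    (hw : qip ((a⁻¹ * b).im - 2 * (a⁻¹ * (a⁻¹ * b).im * a)) (a⁻¹ * b).im = 0) :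
    ∃ x y : ℍ[ℝ], x.re = 0 ∧ y.re = 0 ∧ x ≠ 0 ∧ y ≠ 0 ∧ qip x y = 0 ∧
      Horizontal s g (dg y (-y)) ∧
      Horizontal s g (!![y, x; x, y] : M2) := by
  have hhalf : (1 / Real.sqrt 2) * (1 / Real.sqrt 2) = 1 / 2 := by
    rw [← sq, div_pow, Real.sq_sqrt (by norm_num)]; norm_num
  have hsa : Quaternion.normSq a = 1 / 2 := by
    rw [Quaternion.normSq_eq_norm_mul_self, hna, hhalf]
  have hsb : Quaternion.normSq b = 1 / 2 := by
    rw [Quaternion.normSq_eq_norm_mul_self, hnb, hhalf]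
  have hsI : 1 / 8 ≤ Quaternion.normSq a.im := by
    rw [Quaternion.normSq_eq_norm_mul_self] at hsa ⊢
    nlinarith [norm_nonneg a]
  have ha0 : a ≠ 0 := by rintro rfl; simp at hsa
  have hinv : a⁻¹ = (2 : ℝ) • star a := by
    rw [Quaternion.inv_def, hsa]; norm_num
  set u := a⁻¹ * b with hu
  have huu : u * star u = 1 := by
    rw [Quaternion.self_mul_star, hu, map_mul, map_inv₀, hsa, hsb]; norm_num
  have hbu : b = a * u := by rw [hu, mul_inv_cancel_left₀ ha0]
  have haa : a * star a = ((1 / 2 : ℝ) : ℍ[ℝ]) := by rw [Quaternion.self_mul_star, hsa]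
  rw [ha] at haa
  rw [hb, ha] at hbu
  by_cases hw0 : u.im = 0
  · obtain ⟨y, hy, hy0, h⟩ := exists_qip_conj_eq_zero hsa hsI
    rw [ha] at h
    refine exists_horizontal_pair hs0.ne' g (c := u.re) (t := 0) haa hbu ?_ huu hy hy0 h
    conv_lhs => rw [← Quaternion.re_add_im u, hw0]
    simp
  · refine exists_horizontal_pair hs0.ne' g (c := u.re) (t := 1) haa hbu ?_ huu
      (Quaternion.re_im u) hw0 ?_
    · rw [one_smul, Quaternion.re_add_im]
    · rw [← ha]
      have e : 4 * (star a * u.im * a) - u.im = -(u.im - 2 * (a⁻¹ * u.im * a)) := by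
        have h2 : (2 : ℍ[ℝ]) = ((2 : ℝ) : ℍ[ℝ]) := by norm_cast
        have h4 : (4 : ℍ[ℝ]) = ((4 : ℝ) : ℍ[ℝ]) := by norm_cast
        rw [hinv, h2, h4]
        simp only [Quaternion.coe_mul_eq_smul, smul_mul_assoc, smul_smul]
        norm_num
      rw [e, qip, star_neg, neg_mul, Quaternion.re_neg]
      exact neg_eq_zero.2 hw

end
end

section
/- Let q ∈ ℍ with |q| = 1, let a, b ∈ ℍ be nonzero, and set ã = q·a·q⁻¹ and b̃ = q·b·q⁻¹. Then: (i) D(ã, b̃) = D(a, b); (ii) |ã| = |a|, |b̃| = |b|, |Im ã| = |Im a| and |Im b̃| = |Im b|; (iii) setting w = Im(a⁻¹·b) and w̃ = Im(ã⁻¹·b̃), one has w̃ = q·w·q⁻¹ and ⟨w̃ − 2·ã⁻¹·w̃·ã, w̃⟩ = ⟨w − 2·a⁻¹·w·a, w⟩. -/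
open scoped Quaternion

noncomputable section

theorem Quaternion.re_mul_comm (x y : ℍ[ℝ]) : (x * y).re = (y * x).re := by
  simp only [Quaternion.re_mul]
  ring

theorem Quaternion.re_conj {q : ℍ[ℝ]} (hq : q ≠ 0) (x : ℍ[ℝ]) : (q * x * q⁻¹).re = x.re := by
  rw [Quaternion.re_mul_comm, ← mul_assoc, inv_mul_cancel₀ hq, one_mul]

theorem Quaternion.im_conj {q : ℍ[ℝ]} (hq : q ≠ 0) (x : ℍ[ℝ]) :
    (q * x * q⁻¹).im = q * x.im * q⁻¹ := by
  rw [← Quaternion.sub_re_self, Quaternion.re_conj hq, ← Quaternion.sub_re_self x, mul_sub,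
    sub_mul, ← Quaternion.coe_commutes, mul_assoc (x.re : ℍ[ℝ]), mul_inv_cancel₀ hq, mul_one]

theorem Quaternion.norm_conj {q : ℍ[ℝ]} (hq : q ≠ 0) (x : ℍ[ℝ]) : ‖q * x * q⁻¹‖ = ‖x‖ := by
  rw [norm_mul, norm_mul, norm_inv, mul_right_comm, mul_inv_cancel₀ (norm_ne_zero_iff.2 hq),
    one_mul]

theorem Quaternion.star_eq_inv_of_norm_eq_one {q : ℍ[ℝ]} (hq : ‖q‖ = 1) : star q = q⁻¹ := by
  refine eq_inv_of_mul_eq_one_left ?_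
  rw [Quaternion.star_mul_self, Quaternion.normSq_eq_norm_mul_self, hq]
  simp

theorem qip_conj {q : ℍ[ℝ]} (hq : ‖q‖ = 1) (x y : ℍ[ℝ]) :
    qip (q * x * q⁻¹) (q * y * q⁻¹) = qip x y := by
  have hq0 : q ≠ 0 := norm_ne_zero_iff.1 (by simp [hq])
  have h : star (q * x * q⁻¹) = q * star x * q⁻¹ := by
    rw [← Quaternion.star_eq_inv_of_norm_eq_one hq, star_mul, star_mul, star_star, mul_assoc]
  have h' : q * star x * q⁻¹ * (q * y * q⁻¹) = q * (star x * y) * q⁻¹ := by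
    simp only [mul_assoc, inv_mul_cancel_left₀ hq0]
  rw [qip, h, h', Quaternion.re_conj hq0, qip]

theorem Ad_mul (a b : ℍ[ℝ]) : Ad (a * b) = Ad a ∘ₗ Ad b := by
  ext1 v
  simp [Ad, mul_assoc]

theorem Ad_one : Ad 1 = LinearMap.id := by
  ext1 v
  simp [Ad]

/-- `Ad q` for nonzero `q`, as a linear equivalence with inverse `Ad q⁻¹`. -/
def AdEquiv (q : ℍ[ℝ]) (hq : q ≠ 0) : ℍ[ℝ] ≃ₗ[ℝ] ℍ[ℝ] :=
  LinearEquiv.ofLinearMap (Ad q) (Ad q⁻¹)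
    (by rw [← Ad_mul, mul_inv_cancel₀ hq, Ad_one])
    (by rw [← Ad_mul, inv_mul_cancel₀ hq, Ad_one])

theorem inv_conj (q a : ℍ[ℝ]) : (q * a * q⁻¹)⁻¹ = q * a⁻¹ * q⁻¹ := by
  simp [mul_assoc]

theorem Dd_conj {q : ℍ[ℝ]} (hq : q ≠ 0) (a b : ℍ[ℝ]) :
    Dd (q * a * q⁻¹) (q * b * q⁻¹) = Dd a b := by
  rw [Dd, Dd, ← LinearMap.det_conj (LinearMap.id - Ad a⁻¹ - Ad b⁻¹) (AdEquiv q hq)]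
  congr 1
  have h : Ad q ∘ₗ Ad q⁻¹ = LinearMap.id := by rw [← Ad_mul, mul_inv_cancel₀ hq, Ad_one]
  change _ = Ad q ∘ₗ (LinearMap.id - Ad a⁻¹ - Ad b⁻¹) ∘ₗ Ad q⁻¹
  simp only [inv_conj, Ad_mul, LinearMap.sub_comp, LinearMap.comp_sub, LinearMap.id_comp, h,
    LinearMap.comp_assoc]

/-- Remark 2 of the paper: the conditions defining the zero-curvature locus
are invariant under the replacement (a,b) ↦ (q·a·q⁻¹, q·b·q⁻¹) for a unit
quaternion q. -/
theorem stmt17 (q : ℍ[ℝ]) (hq : ‖q‖ = 1) (a b : ℍ[ℝ]) (ha : a ≠ 0) (hb : b ≠ 0)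
    (a' b' : ℍ[ℝ]) (ha' : a' = q * a * q⁻¹) (hb' : b' = q * b * q⁻¹) :
    Dd a' b' = Dd a b ∧
    ‖a'‖ = ‖a‖ ∧ ‖b'‖ = ‖b‖ ∧ ‖a'.im‖ = ‖a.im‖ ∧ ‖b'.im‖ = ‖b.im‖ ∧
    (a'⁻¹ * b').im = q * (a⁻¹ * b).im * q⁻¹ ∧
    qip ((a'⁻¹ * b').im - 2 * (a'⁻¹ * (a'⁻¹ * b').im * a')) (a'⁻¹ * b').im =
      qip ((a⁻¹ * b).im - 2 * (a⁻¹ * (a⁻¹ * b).im * a)) (a⁻¹ * b).im := by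
  have hq0 : q ≠ 0 := norm_ne_zero_iff.1 (by simp [hq])
  subst ha' hb'
  have hab : (q * a * q⁻¹)⁻¹ * (q * b * q⁻¹) = q * (a⁻¹ * b) * q⁻¹ := by
    rw [inv_conj]
    simp only [mul_assoc, inv_mul_cancel_left₀ hq0]
  have hw : ((q * a * q⁻¹)⁻¹ * (q * b * q⁻¹)).im = q * (a⁻¹ * b).im * q⁻¹ := by
    rw [hab, Quaternion.im_conj hq0]
  refine ⟨Dd_conj hq0 a b, Quaternion.norm_conj hq0 a, Quaternion.norm_conj hq0 b, ?_, ?_, hw, ?_⟩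
  · rw [Quaternion.im_conj hq0, Quaternion.norm_conj hq0]
  · rw [Quaternion.im_conj hq0, Quaternion.norm_conj hq0]
  · rw [hw, ← qip_conj hq ((a⁻¹ * b).im - _)]
    congr 1
    rw [inv_conj]
    simp only [two_mul, mul_sub, sub_mul, mul_add, add_mul, mul_assoc,
      inv_mul_cancel_left₀ hq0]

end
end
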